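/- arXiv:1902.08406 — 3 statements merged into one kernel-verified Lean document; each statement's English description precedes it below -/
import Mathlib

section
/- Let A* be an (r−1)-connected (r > 1) Poincaré DGCA of degree n ≤ 5r−3 of Hodge type, whose harmonic subspace H* is adapted to a generating subspace. Then (H*, m2, m3) is an A_3-algebra with zero differential; explicitly, for all homogeneous α, β, γ, δ ∈ H*: m2 is graded-commutative with unit 1_A, m2 is associative, i.e. m2(m2(α,β),γ) = m2(α,m2(β,γ)), and m3 satisfies the Hochschild 2-cocycle identity m3(m2(α,β),γ,δ) − m3(α,m2(β,γ),δ) + m3(α,β,m2(γ,δ)) = m2(m3(α,β,γ),δ) + (−1)^{|α|} m2(α,m3(β,γ,δ)). -/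
universe u v

open scoped TensorProduct

/-- A (not necessarily commutative) differential graded algebra over `F`:
a nonnegatively graded, associative, unital `F`-algebra equipped with a degree `+1`
differential `d` satisfying `d ∘ d = 0` and the graded Leibniz rule. -/
structure DGA (F : Type u) (A : Type v) [Field F] [Ring A] [Algebra F A] where
  grading : ℤ → Submodule F A
  internal : DirectSum.IsInternal grading
  nonneg : ∀ i : ℤ, i < 0 → grading i = ⊥
  one_mem : (1 : A) ∈ grading 0
  mul_mem : ∀ {i j : ℤ} {a b : A}, a ∈ grading i → b ∈ grading j → a * b ∈ grading (i + j)
  d : A →ₗ[F] A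
  d_mem : ∀ {i : ℤ} {a : A}, a ∈ grading i → d a ∈ grading (i + 1)
  d_d : ∀ a : A, d (d a) = 0
  leibniz : ∀ {i : ℤ} (a b : A), a ∈ grading i →
    d (a * b) = d a * b + ((-1 : F) ^ i) • (a * d b)

namespace DGA

variable {F : Type u} {A : Type v} [Field F] [Ring A] [Algebra F A]

/-- The cocycles of degree `k`. -/
def Zc (D : DGA F A) (k : ℤ) : Submodule F A := D.grading k ⊓ LinearMap.ker D.d

/-- The coboundaries of degree `k`. -/
def Bc (D : DGA F A) (k : ℤ) : Submodule F A := Submodule.map D.d (D.grading (k - 1))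

/-- `a` is exact, i.e. a coboundary. -/
def IsExact (D : DGA F A) (a : A) : Prop := ∃ b, a = D.d b

/-- Two elements define the same cohomology class. -/
def Cohomologous (D : DGA F A) (a b : A) : Prop := ∃ c, a - b = D.d c

/-- `H^0 = F·[1]`. -/
def Connected (D : DGA F A) : Prop :=
  ∀ a ∈ D.grading 0, D.d a = 0 → ∃ c : F, a = c • (1 : A)

/-- Connected and `H^k = 0` for `1 ≤ k ≤ r`.  An `(r-1)`-connected DGA in the sense of
the paper is one satisfying `RConnected (r-1)`. -/
def RConnected (D : DGA F A) (r : ℤ) : Prop :=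
  D.Connected ∧ ∀ k : ℤ, 1 ≤ k → k ≤ r → ∀ a ∈ D.grading k, D.d a = 0 → D.IsExact a

/-- A harmonic subspace: a graded complement of the coboundaries inside the cocycles. -/
def IsHarmonicFamily (D : DGA F A) (H : ℤ → Submodule F A) : Prop :=
  ∀ k : ℤ, H k ≤ D.Zc k ∧ Disjoint (D.Bc k) (H k) ∧ D.Zc k ≤ D.Bc k ⊔ H k

/-- The operator `d⁻` attached to a decomposition `A = dA ⊕ H ⊕ B`: the inverse of
`d : B → dA` extended by `0` on `H ⊕ B`. -/
def IsDminus (D : DGA F A) (H B : ℤ → Submodule F A) (dm : A →ₗ[F] A) : Prop :=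
  (∀ k : ℤ, ∀ b ∈ B k, dm (D.d b) = b) ∧
  (∀ k : ℤ, ∀ h ∈ H k, dm h = 0) ∧
  (∀ k : ℤ, ∀ b ∈ B k, dm b = 0) ∧
  (∀ k : ℤ, ∀ a ∈ D.grading k, dm a ∈ B (k - 1))

/-- The projection `π_H : A → H` with kernel `dA ⊕ B`. -/
def IsHarmonicProj (D : DGA F A) (H B : ℤ → Submodule F A) (pH : A →ₗ[F] A) : Prop :=
  (∀ k : ℤ, ∀ h ∈ H k, pH h = h) ∧
  (∀ k : ℤ, ∀ b ∈ B k, pH b = 0) ∧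
  (∀ a : A, pH (D.d a) = 0) ∧
  (∀ k : ℤ, ∀ a ∈ D.grading k, pH a ∈ H k)

/-- The degree of the entry `a i j` of a defining system: `|x_i| + ⋯ + |x_j| - (j - i)`. -/
def degSum (deg : ℕ → ℤ) (i j : ℕ) : ℤ :=
  (∑ t ∈ Finset.Icc i j, deg t) - ((j - i : ℕ) : ℤ)

/-- A defining system for the `l`-th order Massey product of the classes of the
cocycles `x 1, …, x l` (of degrees `deg 1, …, deg l`). -/
def IsDefiningSystem (D : DGA F A) (l : ℕ) (deg : ℕ → ℤ) (x : ℕ → A)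
    (a : ℕ → ℕ → A) : Prop :=
  (∀ i : ℕ, 1 ≤ i → i ≤ l →
      a i i ∈ D.grading (deg i) ∧ D.d (a i i) = 0 ∧ D.Cohomologous (a i i) (x i)) ∧
  (∀ i j : ℕ, 1 ≤ i → i ≤ j → j ≤ l → a i j ∈ D.grading (degSum deg i j)) ∧
  (∀ i j : ℕ, 1 ≤ i → i < j → j ≤ l → ¬(i = 1 ∧ j = l) →
    D.d (a i j) = ∑ k ∈ Finset.Ico i j, ((-1 : F) ^ degSum deg i k) • (a i k * a (k + 1) j))

/-- The cocycle `∑ ā_{1k} a_{k+1,l}` produced by a defining system. -/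
def masseyOut (D : DGA F A) (l : ℕ) (deg : ℕ → ℤ) (a : ℕ → ℕ → A) : A :=
  ∑ k ∈ Finset.Ico 1 l, ((-1 : F) ^ degSum deg 1 k) • (a 1 k * a (k + 1) l)

/-- `(x 1, …, x l)` is a Massey `l`-tuple: the Massey product is nonempty. -/
def IsMasseyTuple (D : DGA F A) (l : ℕ) (deg : ℕ → ℤ) (x : ℕ → A) : Prop :=
  (∀ i : ℕ, 1 ≤ i → i ≤ l → x i ∈ D.Zc (deg i)) ∧ ∃ a, D.IsDefiningSystem l deg x a

/-- The `l`-th order Massey product of `(x 1, …, x l)` is trivial: it contains `0`. -/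
def MasseyTrivial (D : DGA F A) (l : ℕ) (deg : ℕ → ℤ) (x : ℕ → A) : Prop :=
  ∃ a, D.IsDefiningSystem l deg x a ∧ D.IsExact (D.masseyOut l deg a)

end DGA

/-- A differential graded commutative algebra (DGCA) over `F`. -/
structure DGCA (F : Type u) (A : Type v) [Field F] [Ring A] [Algebra F A]
    extends DGA F A where
  gcomm : ∀ {i j : ℤ} (a b : A), a ∈ grading i → b ∈ grading j →
    a * b = ((-1 : F) ^ (i * j)) • (b * a)

/-- A Poincaré DGCA of degree `n`: a DGCA concentrated in degrees `0, …, n`, with finite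
dimensional cohomology, equipped with a linear functional `∫` (given here as `intg`, a
functional on `A` vanishing in degrees `≠ n` and on coboundaries) such that the induced
pairing `⟨a, b⟩ = ∫ [a * b]` is nondegenerate on cohomology. -/
structure PoincareDGCA (F : Type u) (A : Type v) [Field F] [Ring A] [Algebra F A]
    (n : ℤ) extends DGCA F A where
  top : ∀ i : ℤ, n < i → grading i = ⊥
  fin_cohomology : ∀ k : ℤ, ∃ W : Submodule F A, FiniteDimensional F W ∧
    ∀ a ∈ grading k, d a = 0 → ∃ w ∈ W, ∃ c, a - w = d c
  intg : A →ₗ[F] F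
  intg_deg : ∀ i : ℤ, i ≠ n → ∀ a ∈ grading i, intg a = 0
  intg_d : ∀ a : A, intg (d a) = 0
  nondeg : ∀ i : ℤ, ∀ a ∈ grading i, d a = 0 →
    (∀ b ∈ grading (n - i), d b = 0 → intg (a * b) = 0) → ∃ c, a = d c

namespace PoincareDGCA

variable {F : Type u} {A : Type v} [Field F] [Ring A] [Algebra F A] {n : ℤ}

/-- The null space `A⊥` of the induced pairing `⟨a, b⟩ = ∫ (a * b)` on `A`. -/
def perp (P : PoincareDGCA F A n) : Submodule F A :=
  ⨅ b : A, LinearMap.ker (P.intg ∘ₗ LinearMap.mulRight F b)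

/-- `A = dA ⊕ H ⊕ B` is a Hodge type decomposition: `H` is a harmonic subspace,
`B` is a graded complement, and `⟨H ⊕ B, B⟩ = 0`. -/
def IsHodge (P : PoincareDGCA F A n) (H B : ℤ → Submodule F A) : Prop :=
  P.toDGA.IsHarmonicFamily H ∧
  (∀ k : ℤ, B k ≤ P.grading k) ∧
  (∀ k : ℤ, Disjoint (P.toDGA.Bc k ⊔ H k) (B k)) ∧
  (∀ k : ℤ, P.grading k ≤ P.toDGA.Bc k ⊔ H k ⊔ B k) ∧
  (∀ j k : ℤ, ∀ a ∈ H j ⊔ B j, ∀ b ∈ B k, P.intg (a * b) = 0)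

/-- A Poincaré DGCA of Hodge type: one admitting a Hodge type decomposition. -/
def HodgeType (P : PoincareDGCA F A n) : Prop := ∃ H B, P.IsHodge H B

end PoincareDGCA

/-- A bundled DGCA over `F`. -/
structure BDGCA (F : Type u) [Field F] : Type (max (u + 1) (v + 1)) where
  carrier : Type v
  [ringInst : Ring carrier]
  [algInst : Algebra F carrier]
  str : DGCA F carrier

attribute [instance] BDGCA.ringInst BDGCA.algInst

/-- A morphism of DGCAs: an algebra homomorphism preserving the grading and
commuting with the differentials. -/
structure DGCAHom {F : Type u} [Field F] (X Y : BDGCA.{u, v} F) where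
  f : X.carrier →ₐ[F] Y.carrier
  map_grading : ∀ i : ℤ, ∀ a ∈ X.str.grading i, f a ∈ Y.str.grading i
  map_d : ∀ a, f (X.str.d a) = Y.str.d (f a)

/-- A quasi-isomorphism: a DGCA morphism inducing an isomorphism on cohomology. -/
def DGCAHom.QuasiIso {F : Type u} [Field F] {X Y : BDGCA.{u, v} F}
    (φ : DGCAHom X Y) : Prop :=
  (∀ i : ℤ, ∀ a ∈ X.str.grading i, X.str.d a = 0 →
    (∃ b, φ.f a = Y.str.d b) → ∃ c, a = X.str.d c) ∧
  (∀ i : ℤ, ∀ a' ∈ Y.str.grading i, Y.str.d a' = 0 →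
    ∃ a ∈ X.str.grading i, X.str.d a = 0 ∧ ∃ b, φ.f a - a' = Y.str.d b)

/-- Two DGCAs are equivalent if they are joined by a finite zig-zag of
quasi-isomorphisms. -/
def DGCAEquivalent {F : Type u} [Field F] : BDGCA.{u, v} F → BDGCA.{u, v} F → Prop :=
  Relation.EqvGen fun X Y => ∃ φ : DGCAHom X Y, φ.QuasiIso

/-- A DGCA is formal if it is equivalent to a DGCA with zero differential
(equivalently, to its cohomology with the zero differential). -/
def DGCAFormal {F : Type u} [Field F] (X : BDGCA.{u, v} F) : Prop :=
  ∃ Y : BDGCA.{u, v} F, Y.str.d = 0 ∧ DGCAEquivalent X Y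

variable {F : Type u} {A : Type v} [Field F] [Ring A] [Algebra F A]

/-- The binary multiplication `m₂(α,β) = π_H(α·β)` on the harmonic subspace. -/
def m2 (pH : A →ₗ[F] A) (a b : A) : A := pH (a * b)

/-- The ternary multiplication
`m₃(α,β,γ) = π_H(d⁻(α·β)·γ - (-1)^{|α|} α·d⁻(β·γ))`, for `α` of degree `i`. -/
def m3 (pH dm : A →ₗ[F] A) (i : ℤ) (a b c : A) : A :=
  pH (dm (a * b) * c - ((-1 : F) ^ i) • (a * dm (b * c)))

/-- The span, in degree `k`, of products of two positive-degree cocycles. -/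
def posProdSpan (D : DGA F A) (k : ℤ) : Submodule F A :=
  Submodule.span F {x : A | ∃ i j : ℤ, 1 ≤ i ∧ 1 ≤ j ∧ i + j = k ∧
    ∃ a ∈ D.Zc i, ∃ b ∈ D.Zc j, x = a * b}

/-- A graded family `G` of cocycles representing a generating subspace
`H*_gen ⊆ H*₊` together with a partial splitting map `ι₀`. -/
def IsGeneratingFamily (D : DGA F A) (G : ℤ → Submodule F A) : Prop :=
  (∀ k : ℤ, G k ≤ D.Zc k) ∧
  (∀ k : ℤ, k ≤ 0 → G k = ⊥) ∧
  (∀ k : ℤ, Disjoint (G k) (posProdSpan D k ⊔ D.Bc k)) ∧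
  (∀ k : ℤ, 1 ≤ k → D.Zc k ≤ G k ⊔ posProdSpan D k ⊔ D.Bc k)

/-- The harmonic subspace `H'` is adapted to the generating subspace encoded by `G`. -/
def IsAdaptedHarmonic (D : DGA F A) (G H' : ℤ → Submodule F A) : Prop :=
  D.IsHarmonicFamily H' ∧ (∀ k : ℤ, G k ≤ H' k) ∧
  (∀ k : ℤ, H' k ≤ Subalgebra.toSubmodule (Algebra.adjoin F {a : A | ∃ j : ℤ, a ∈ G j}))

namespace PoincareDGCA

variable {n : ℤ}

/-- The homotopy identity `id = π_H + d d⁻ + d⁻ d` of a Hodge type decomposition. -/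
theorem IsHodge.homotopy {P : PoincareDGCA F A n} {H B : ℤ → Submodule F A}
    (hHodge : P.IsHodge H B) {dm : A →ₗ[F] A} (hdm : P.toDGA.IsDminus H B dm)
    {pH : A →ₗ[F] A} (hpH : P.toDGA.IsHarmonicProj H B pH)
    {k : ℤ} {a : A} (ha : a ∈ P.grading k) :
    a = pH a + P.d (dm a) + dm (P.d a) := by
  have split : ∀ (k : ℤ) (a : A), a ∈ P.grading k → ∃ x ∈ P.grading (k - 1),
      ∃ h ∈ H k, ∃ b ∈ B k, a = P.d x + h + b := by
    intro k a ha
    obtain ⟨y, hy, b, hb, rfl⟩ := Submodule.mem_sup.1 (hHodge.2.2.2.1 k ha)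
    obtain ⟨z, ⟨x, hx, rfl⟩, h, hh, rfl⟩ := Submodule.mem_sup.1 hy
    exact ⟨x, hx, h, hh, b, hb, rfl⟩
  have closed : ∀ (k : ℤ) (h : A), h ∈ H k → P.d h = 0 := fun k h hh =>
    LinearMap.mem_ker.1 ((hHodge.1 k).1 hh).2
  obtain ⟨x, hx, h, hh, b, hb, rfl⟩ := split k a ha
  obtain ⟨y, -, h', hh', b', hb', rfl⟩ := split (k - 1) x hx
  simp only [map_add, P.d_d, closed _ _ hh, closed _ _ hh', hdm.1 _ _ hb, hdm.1 _ _ hb',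
    hdm.2.1 _ _ hh, hdm.2.2.1 _ _ hb, hpH.1 _ _ hh, hpH.2.1 _ _ hb, hpH.2.2.1,
    zero_add, add_zero]
  abel

end PoincareDGCA

/-- The cochain `d⁻(α·β)·γ - (-1)^{|α|} α·d⁻(β·γ)` whose harmonic part is `m₃(α,β,γ)`. -/
def m3Cochain (dm : A →ₗ[F] A) (i : ℤ) (a b c : A) : A :=
  dm (a * b) * c - ((-1 : F) ^ i) • (a * dm (b * c))

namespace PoincareDGCA

variable {n : ℤ} {P : PoincareDGCA F A n} {H B : ℤ → Submodule F A}
  {dm pH : A →ₗ[F] A}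

theorem IsHodge.mem_grading (hHodge : P.IsHodge H B) {k : ℤ} {a : A} (ha : a ∈ H k) :
    a ∈ P.grading k :=
  ((hHodge.1 k).1 ha).1

theorem IsHodge.d_eq_zero (hHodge : P.IsHodge H B) {k : ℤ} {a : A} (ha : a ∈ H k) :
    P.d a = 0 :=
  LinearMap.mem_ker.1 ((hHodge.1 k).1 ha).2

theorem IsHodge.dm_mem (hHodge : P.IsHodge H B) (hdm : P.toDGA.IsDminus H B dm)
    {k : ℤ} {a : A} (ha : a ∈ P.grading k) : dm a ∈ P.grading (k - 1) :=
  hHodge.2.1 _ (hdm.2.2.2 k a ha)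

theorem IsHodge.d_mul_eq_zero (hHodge : P.IsHodge H B) {i j : ℤ} {a b : A}
    (ha : a ∈ H i) (hb : b ∈ H j) : P.d (a * b) = 0 := by
  rw [P.leibniz a b (hHodge.mem_grading ha), hHodge.d_eq_zero ha, hHodge.d_eq_zero hb]
  simp

/-- The exact part of a product of harmonic elements. -/
theorem IsHodge.d_dm_mul (hHodge : P.IsHodge H B) (hdm : P.toDGA.IsDminus H B dm)
    (hpH : P.toDGA.IsHarmonicProj H B pH) {i j : ℤ} {a b : A}
    (ha : a ∈ H i) (hb : b ∈ H j) : P.d (dm (a * b)) = a * b - pH (a * b) := by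
  have h := hHodge.homotopy hdm hpH
    (P.mul_mem (hHodge.mem_grading ha) (hHodge.mem_grading hb))
  rw [hHodge.d_mul_eq_zero ha hb, map_zero, add_zero] at h
  exact eq_sub_of_add_eq' h.symm

theorem IsHodge.proj_d_mul (hpH : P.toDGA.IsHarmonicProj H B pH) {k : ℤ} {u c : A}
    (hu : u ∈ P.grading k) (hc : P.d c = 0) : pH (P.d u * c) = 0 := by
  have h := hpH.2.2.1 (u * c)
  rwa [P.leibniz u c hu, hc, mul_zero, smul_zero, add_zero] at h

theorem IsHodge.proj_mul_d (hpH : P.toDGA.IsHarmonicProj H B pH) {k : ℤ} {u c : A}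
    (hc : c ∈ P.grading k) (hc' : P.d c = 0) : pH (c * P.d u) = 0 := by
  have h := hpH.2.2.1 (c * u)
  rw [P.leibniz c u hc, hc', zero_mul, zero_add, map_smul] at h
  exact (smul_eq_zero.1 h).resolve_left (zpow_ne_zero _ (neg_ne_zero.2 one_ne_zero))

theorem IsHodge.proj_proj_mul (hHodge : P.IsHodge H B) (hdm : P.toDGA.IsDminus H B dm)
    (hpH : P.toDGA.IsHarmonicProj H B pH) {k : ℤ} {x c : A}
    (hx : x ∈ P.grading k) (hc : P.d c = 0) :
    pH (pH x * c) = pH (x * c) - pH (dm (P.d x) * c) := by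
  conv_rhs => enter [1]; rw [hHodge.homotopy hdm hpH hx]
  rw [add_mul, add_mul, map_add, map_add,
    IsHodge.proj_d_mul hpH (hHodge.dm_mem hdm hx) hc]
  abel

theorem IsHodge.proj_mul_proj (hHodge : P.IsHodge H B) (hdm : P.toDGA.IsDminus H B dm)
    (hpH : P.toDGA.IsHarmonicProj H B pH) {k l : ℤ} {x c : A}
    (hx : x ∈ P.grading k) (hc : c ∈ P.grading l) (hc' : P.d c = 0) :
    pH (c * pH x) = pH (c * x) - pH (c * dm (P.d x)) := by
  conv_rhs => enter [1]; rw [hHodge.homotopy hdm hpH hx]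
  rw [mul_add, mul_add, map_add, map_add, IsHodge.proj_mul_d hpH hc hc']
  abel

theorem neg_one_zpow_mul_self (i : ℤ) : (-1 : F) ^ i * (-1 : F) ^ i = 1 := by
  rw [← mul_zpow]; simp

theorem IsHodge.m3Cochain_mem (hHodge : P.IsHodge H B) (hdm : P.toDGA.IsDminus H B dm)
    {i j k : ℤ} {a b c : A} (ha : a ∈ H i) (hb : b ∈ H j) (hc : c ∈ H k) :
    m3Cochain dm i a b c ∈ P.grading (i + j + k - 1) := by
  have ha' := hHodge.mem_grading ha
  have hb' := hHodge.mem_grading hb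
  have hc' := hHodge.mem_grading hc
  refine Submodule.sub_mem _ ?_ (Submodule.smul_mem _ _ ?_)
  · convert P.mul_mem (hHodge.dm_mem hdm (P.mul_mem ha' hb')) hc' using 2
    ring
  · convert P.mul_mem ha' (hHodge.dm_mem hdm (P.mul_mem hb' hc')) using 2
    ring

theorem IsHodge.d_m3Cochain (hHodge : P.IsHodge H B) (hdm : P.toDGA.IsDminus H B dm)
    (hpH : P.toDGA.IsHarmonicProj H B pH)
    {i j k : ℤ} {a b c : A} (ha : a ∈ H i) (hb : b ∈ H j) (hc : c ∈ H k) :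
    P.d (m3Cochain dm i a b c) = a * pH (b * c) - pH (a * b) * c := by
  have ha' := hHodge.mem_grading ha
  have hb' := hHodge.mem_grading hb
  rw [m3Cochain, map_sub, map_smul, P.leibniz _ c (hHodge.dm_mem hdm (P.mul_mem ha' hb')),
    P.leibniz a _ ha', hHodge.d_eq_zero ha, hHodge.d_eq_zero hc,
    hHodge.d_dm_mul hdm hpH ha hb, hHodge.d_dm_mul hdm hpH hb hc, mul_zero, smul_zero,
    add_zero, zero_mul, zero_add, smul_smul, neg_one_zpow_mul_self, one_smul]
  noncomm_ring

/-- Up to harmonic projection, `d⁻(α·β)·d(d⁻(γ·δ))` and `d(d⁻(α·β))·d⁻(γ·δ)` agree up to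
sign. -/
theorem IsHodge.proj_exchange (hHodge : P.IsHodge H B) (hdm : P.toDGA.IsDminus H B dm)
    (hpH : P.toDGA.IsHarmonicProj H B pH) {i j k l : ℤ} {a b c e : A}
    (ha : a ∈ H i) (hb : b ∈ H j) (hc : c ∈ H k) (he : e ∈ H l) :
    pH (dm (a * b) * (c * e)) - pH (dm (a * b) * pH (c * e)) =
      ((-1 : F) ^ i * (-1 : F) ^ j) •
        (pH (a * b * dm (c * e)) - pH (pH (a * b) * dm (c * e))) := by
  have hu := hHodge.dm_mem hdm
    (P.mul_mem (hHodge.mem_grading ha) (hHodge.mem_grading hb))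
  have h := hpH.2.2.1 (dm (a * b) * dm (c * e))
  have hne : (-1 : F) ≠ 0 := neg_ne_zero.2 one_ne_zero
  rw [P.leibniz _ _ hu, hHodge.d_dm_mul hdm hpH ha hb, hHodge.d_dm_mul hdm hpH hc he,
    map_add, map_smul, sub_mul, mul_sub, map_sub, map_sub, zpow_sub₀ hne,
    zpow_add₀ hne, zpow_one, div_neg, div_one, neg_smul, ← sub_eq_add_neg, sub_eq_zero] at h
  rw [h, smul_smul]
  have hs : (-1 : F) ^ i * (-1 : F) ^ j * ((-1 : F) ^ i * (-1 : F) ^ j) = 1 := by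
    linear_combination ((-1 : F) ^ j * (-1 : F) ^ j) * neg_one_zpow_mul_self (F := F) i
      + neg_one_zpow_mul_self (F := F) j
  rw [hs, one_smul]

/-- The ternary operation `m₃` is a Hochschild `2`-cocycle for `m₂`. -/
theorem IsHodge.m3_cocycle (hHodge : P.IsHodge H B) (hdm : P.toDGA.IsDminus H B dm)
    (hpH : P.toDGA.IsHarmonicProj H B pH) {i j k l : ℤ} {a b c e : A}
    (ha : a ∈ H i) (hb : b ∈ H j) (hc : c ∈ H k) (he : e ∈ H l) :
    m3 pH dm (i + j) (m2 pH a b) c e - m3 pH dm i a (m2 pH b c) e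
        + m3 pH dm i a b (m2 pH c e)
      = m2 pH (m3 pH dm i a b c) e + ((-1 : F) ^ i) • m2 pH a (m3 pH dm j b c e) := by
  have hL := hHodge.proj_proj_mul hdm hpH (hHodge.m3Cochain_mem hdm ha hb hc)
    (hHodge.d_eq_zero he)
  have hR := hHodge.proj_mul_proj hdm hpH (hHodge.m3Cochain_mem hdm hb hc he)
    (hHodge.mem_grading ha) (hHodge.d_eq_zero ha)
  have hX := hHodge.proj_exchange hdm hpH ha hb hc he
  rw [hHodge.d_m3Cochain hdm hpH ha hb hc] at hL
  rw [hHodge.d_m3Cochain hdm hpH hb hc he] at hR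
  change _ = pH (pH (m3Cochain dm i a b c) * e)
    + ((-1 : F) ^ i) • pH (a * pH (m3Cochain dm j b c e))
  rw [hL, hR]
  simp only [m2, m3, m3Cochain, map_sub, map_smul, sub_mul, mul_sub, smul_mul_assoc,
    mul_smul_comm, ← mul_assoc, zpow_add₀ (neg_ne_zero.2 (one_ne_zero (α := F)))] at hX ⊢
  linear_combination (norm := module) (-1 : F) • hX

/-- The induced product `m₂` is associative. -/
theorem IsHodge.m2_assoc (hHodge : P.IsHodge H B) (hdm : P.toDGA.IsDminus H B dm)
    (hpH : P.toDGA.IsHarmonicProj H B pH) {i j k : ℤ} {a b c : A}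
    (ha : a ∈ H i) (hb : b ∈ H j) (hc : c ∈ H k) :
    m2 pH (m2 pH a b) c = m2 pH a (m2 pH b c) := by
  have ha' := hHodge.mem_grading ha
  have hb' := hHodge.mem_grading hb
  have hc' := hHodge.mem_grading hc
  rw [m2, m2, m2, m2,
    hHodge.proj_proj_mul hdm hpH (P.mul_mem ha' hb') (hHodge.d_eq_zero hc),
    hHodge.proj_mul_proj hdm hpH (P.mul_mem hb' hc') ha' (hHodge.d_eq_zero ha),
    hHodge.d_mul_eq_zero ha hb, hHodge.d_mul_eq_zero hb hc]
  simp [mul_assoc]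

theorem IsHodge.one_mem_harmonic (hHodge : P.IsHodge H B) : (1 : A) ∈ H 0 := by
  have hd : P.d (1 : A) = 0 := by
    have h := P.leibniz (1 : A) 1 P.one_mem
    simpa using h
  have hB : P.toDGA.Bc 0 = ⊥ := by
    rw [DGA.Bc, P.nonneg (0 - 1) (by norm_num), Submodule.map_bot]
  have h := (hHodge.1 0).2.2 ⟨P.one_mem, LinearMap.mem_ker.2 hd⟩
  rwa [hB, bot_sup_eq] at h

end PoincareDGCA

/-- Let `A*` be an `(r-1)`-connected (`r > 1`) Poincaré DGCA of degree
`n ≤ 5r-3` of Hodge type with adapted harmonic subspace `H`.  Then `(H, m₂, m₃)` is an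
`A₃`-algebra with zero differential: `m₂` is graded commutative with unit `1`,
associative, and `m₃` satisfies the Hochschild `2`-cocycle identity. -/
theorem statement_10 {n : ℤ} (P : PoincareDGCA F A n) (r : ℤ) (hr : 1 < r)
    (hconn : P.toDGA.RConnected (r - 1)) (hdim : n ≤ 5 * r - 3)
    (H B : ℤ → Submodule F A) (hHodge : P.IsHodge H B)
    (hadapted : ∃ G : ℤ → Submodule F A,
      IsGeneratingFamily P.toDGA G ∧ IsAdaptedHarmonic P.toDGA G H)
    (dm : A →ₗ[F] A) (hdm : P.toDGA.IsDminus H B dm)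
    (pH : A →ₗ[F] A) (hpH : P.toDGA.IsHarmonicProj H B pH) :
    -- `1` is harmonic and is a unit for `m₂`
    ((1 : A) ∈ H 0) ∧
    (∀ (i : ℤ) (α : A), α ∈ H i → m2 pH (1 : A) α = α ∧ m2 pH α (1 : A) = α) ∧
    -- `m₂` is graded commutative
    (∀ (i j : ℤ) (α β : A), α ∈ H i → β ∈ H j →
      m2 pH α β = ((-1 : F) ^ (i * j)) • m2 pH β α) ∧
    -- `m₂` is associative
    (∀ (i j k : ℤ) (α β γ : A), α ∈ H i → β ∈ H j → γ ∈ H k →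
      m2 pH (m2 pH α β) γ = m2 pH α (m2 pH β γ)) ∧
    -- `m₃` is a Hochschild `2`-cocycle for `m₂`
    (∀ (i j k l : ℤ) (α β γ δ : A), α ∈ H i → β ∈ H j → γ ∈ H k → δ ∈ H l →
      m3 pH dm (i + j) (m2 pH α β) γ δ - m3 pH dm i α (m2 pH β γ) δ
          + m3 pH dm i α β (m2 pH γ δ)
        = m2 pH (m3 pH dm i α β γ) δ + ((-1 : F) ^ i) • m2 pH α (m3 pH dm j β γ δ)) := by
  refine ⟨hHodge.one_mem_harmonic, fun i α hα => ?_, fun i j α β hα hβ => ?_,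
    fun i j k α β γ hα hβ hγ => hHodge.m2_assoc hdm hpH hα hβ hγ,
    fun i j k l α β γ δ hα hβ hγ hδ => hHodge.m3_cocycle hdm hpH hα hβ hγ hδ⟩
  · simp [m2, hpH.1 i α hα]
  · rw [m2, m2, ← map_smul,
      ← P.gcomm α β (hHodge.mem_grading hα) (hHodge.mem_grading hβ)]
end

section
/- Let A* be an (r−1)-connected (r > 1) Poincaré DGCA of degree n of Hodge type, whose harmonic subspace H* is adapted to a generating subspace. If n ≤ 4r−2, then m3(α,β,γ) = 0 for all homogeneous α, β, γ ∈ H*. -/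
universe u v

open scoped TensorProduct

variable {F : Type u} {A : Type v} [Field F] [Ring A] [Algebra F A]

namespace DGA

theorem d_one (D : DGA F A) : D.d 1 = 0 := by
  have h := D.leibniz (1 : A) 1 D.one_mem
  simpa using h

theorem IsHarmonicProj.eq_zero_of_isExact {D : DGA F A} {H B : ℤ → Submodule F A}
    {pH : A →ₗ[F] A} (hpH : D.IsHarmonicProj H B pH) {k : ℤ} {a : A} (ha : a ∈ H k)
    (hex : D.IsExact a) : a = 0 := by
  obtain ⟨b, rfl⟩ := hex
  rw [← hpH.1 k _ ha, hpH.2.2.1]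

theorem IsHarmonicFamily.one_mem {D : DGA F A} {H : ℤ → Submodule F A}
    (hH : D.IsHarmonicFamily H) : (1 : A) ∈ H 0 := by
  have h := (hH 0).2.2 ⟨D.one_mem, D.d_one⟩
  have hB : D.Bc 0 = ⊥ := by
    rw [Bc, D.nonneg (0 - 1) (by norm_num), Submodule.map_bot]
  rwa [hB, bot_sup_eq] at h

/-- In a connected DGA whose cohomology vanishes in degrees `1, …, r - 1`, a harmonic element
is zero, a scalar, or of degree at least `r`. -/
theorem RConnected.eq_smul_one_or_le {D : DGA F A} {r : ℤ} (hconn : D.RConnected (r - 1))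
    {H B : ℤ → Submodule F A} (hH : D.IsHarmonicFamily H) {pH : A →ₗ[F] A}
    (hpH : D.IsHarmonicProj H B pH) {k : ℤ} {a : A} (ha : a ∈ H k) :
    (∃ c : F, a = c • (1 : A)) ∨ r ≤ k := by
  have hg : a ∈ D.grading k := ((hH k).1 ha).1
  have hd : D.d a = 0 := ((hH k).1 ha).2
  rcases lt_trichotomy k 0 with hk | rfl | hk
  · rw [D.nonneg k hk, Submodule.mem_bot] at hg
    exact Or.inl ⟨0, by simp [hg]⟩
  · exact Or.inl (hconn.1 a hg hd)
  · rcases lt_or_ge k r with hkr | hkr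
    · have h := hpH.eq_zero_of_isExact ha (hconn.2 k (by lia) (by lia) a hg hd)
      exact Or.inl ⟨0, by simp [h]⟩
    · exact Or.inr hkr

end DGA

namespace PoincareDGCA

theorem intg_mul_d {n : ℤ} (P : PoincareDGCA F A n) {k : ℤ} {a : A} (ha : a ∈ P.grading k)
    (hd : P.d a = 0) (b : A) : P.intg (a * P.d b) = 0 := by
  have h := P.intg_d (a * b)
  rw [P.leibniz a b ha, hd, zero_mul, zero_add, map_smul, smul_eq_mul] at h
  exact (mul_eq_zero.mp h).resolve_left (zpow_ne_zero _ (by simp))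

theorem IsHodge.intg_mul_left {n : ℤ} {P : PoincareDGCA F A n} {H B : ℤ → Submodule F A}
    (h : P.IsHodge H B) {j k : ℤ} {a b : A} (ha : a ∈ H j) (hb : b ∈ B k) :
    P.intg (a * b) = 0 :=
  h.2.2.2.2 j k a (Submodule.mem_sup_left ha) b hb

theorem IsHodge.intg_mul_right {n : ℤ} {P : PoincareDGCA F A n} {H B : ℤ → Submodule F A}
    (h : P.IsHodge H B) {j k : ℤ} {a b : A} (ha : a ∈ H j) (hb : b ∈ B k) :
    P.intg (b * a) = 0 := by
  rw [P.gcomm b a (h.2.1 k hb) ((h.1 j).1 ha).1, map_smul, h.intg_mul_left ha hb, smul_zero]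

theorem IsHodge.intg_harmonicProj {n : ℤ} {P : PoincareDGCA F A n} {H B : ℤ → Submodule F A}
    (h : P.IsHodge H B) {pH : A →ₗ[F] A} (hpH : P.toDGA.IsHarmonicProj H B pH) {k : ℤ} {a : A}
    (ha : a ∈ P.grading k) : P.intg (pH a) = P.intg a := by
  obtain ⟨x, hx, b, hb, rfl⟩ := Submodule.mem_sup.mp (h.2.2.2.1 k ha)
  obtain ⟨y, ⟨e, -, rfl⟩, z, hz, rfl⟩ := Submodule.mem_sup.mp hx
  have hb1 := h.intg_mul_left h.1.one_mem hb
  rw [one_mul] at hb1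
  simp [hpH.2.2.1 e, hpH.1 k z hz, hpH.2.1 k b hb, P.intg_d, hb1]

end PoincareDGCA

/-- For an `(r-1)`-connected (`r > 1`) Poincaré DGCA of degree
`n ≤ 4r-2` of Hodge type with adapted harmonic subspace, the ternary multiplication
`m₃` vanishes on harmonic elements. -/
theorem statement_11 {n : ℤ} (P : PoincareDGCA F A n) (r : ℤ) (hr : 1 < r)
    (hconn : P.toDGA.RConnected (r - 1)) (hdim : n ≤ 4 * r - 2)
    (H B : ℤ → Submodule F A) (hHodge : P.IsHodge H B)
    (hadapted : ∃ G : ℤ → Submodule F A,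
      IsGeneratingFamily P.toDGA G ∧ IsAdaptedHarmonic P.toDGA G H)
    (dm : A →ₗ[F] A) (hdm : P.toDGA.IsDminus H B dm)
    (pH : A →ₗ[F] A) (hpH : P.toDGA.IsHarmonicProj H B pH) :
    ∀ (i j k : ℤ) (α β γ : A), α ∈ H i → β ∈ H j → γ ∈ H k →
      m3 pH dm i α β γ = 0 := by
  intro i j k α β γ hα hβ hγ
  have hH := hHodge.1
  have hBg := hHodge.2.1
  have hαg := ((hH i).1 hα).1
  have hβg := ((hH j).1 hβ).1
  have hγg := ((hH k).1 hγ).1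
  have hαβ := hdm.2.2.2 _ _ (P.mul_mem hαg hβg)
  have hβγ := hdm.2.2.2 _ _ (P.mul_mem hβg hγg)
  rcases hconn.eq_smul_one_or_le hH hpH hα with ⟨c, rfl⟩ | hi
  · simp [m3, hdm.2.1 j β hβ, hpH.2.1 _ _ hβγ]
  rcases hconn.eq_smul_one_or_le hH hpH hγ with ⟨c, rfl⟩ | hk
  · simp [m3, hdm.2.1 j β hβ, hpH.2.1 _ _ hαβ]
  rcases hconn.eq_smul_one_or_le hH hpH hβ with ⟨c, rfl⟩ | hj
  · simp [m3, hdm.2.1 i α hα, hdm.2.1 k γ hγ]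
  have hmem : dm (α * β) * γ - ((-1 : F) ^ i) • (α * dm (β * γ)) ∈
      P.grading (i + j + k - 1) := by
    refine Submodule.sub_mem _ ?_ (Submodule.smul_mem _ _ ?_)
    · convert P.mul_mem (hBg _ hαβ) hγg using 2; ring
    · convert P.mul_mem hαg (hBg _ hβγ) using 2; ring
  have hm3 : m3 pH dm i α β γ ∈ H (i + j + k - 1) := hpH.2.2.2 _ _ hmem
  obtain ⟨hm3g, hm3d⟩ := (hH _).1 hm3
  refine hpH.eq_zero_of_isExact hm3 (P.nondeg _ _ hm3g hm3d fun b hb hbd => ?_)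
  rcases lt_trichotomy (n - (i + j + k - 1)) 0 with hl | hl | hl
  · rw [P.nonneg _ hl, Submodule.mem_bot] at hb
    rw [hb, mul_zero, map_zero]
  · rw [hl] at hb
    obtain ⟨c, rfl⟩ := hconn.1 b hb hbd
    rw [mul_smul_comm, mul_one, map_smul, m3, hHodge.intg_harmonicProj hpH hmem, map_sub, map_smul,
      hHodge.intg_mul_right hγ hαβ, hHodge.intg_mul_left hα hβγ]
    simp
  · obtain ⟨e, rfl⟩ := hconn.2 _ (by lia) (by lia) b hb hbd
    exact P.intg_mul_d hm3g hm3d e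
end

section
/- Let A* be a DGCA and (x_1,…,x_l), l ≥ 3, a Massey l-tuple of homogeneous cohomology classes. Then the l-th order Massey product ⟨x_1,…,x_l⟩ is trivial (contains 0) if any one of the following holds: (1) x_p = 0 for some p; (2) A* is connected and |x_p| = 0 for some p; (3) A* is a connected Poincaré DGCA of degree n and Σ_{i=1}^l |x_i| + 2 − l = n. -/
universe u v

open scoped TensorProduct

namespace DGA

variable {F : Type u} {A : Type v} [Field F] [Ring A] [Algebra F A]

theorem degSum_add_degSum (deg : ℕ → ℤ) {i k j : ℕ} (hik : i ≤ k) (hkj : k < j) :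
    degSum deg i k + degSum deg (k + 1) j = degSum deg i j + 1 := by
  have hsum : ∑ t ∈ Finset.Icc i k, deg t + ∑ t ∈ Finset.Icc (k + 1) j, deg t
      = ∑ t ∈ Finset.Icc i j, deg t := by
    have h := Finset.sum_Ico_consecutive deg (m := i) (n := k + 1) (k := j + 1)
      (by omega) (by omega)
    simpa only [Finset.Ico_add_one_right_eq_Icc] using h
  unfold degSum
  rw [← hsum]
  push_cast [Nat.cast_sub hik, Nat.cast_sub (Nat.succ_le_of_lt hkj),
    Nat.cast_sub (hik.trans hkj.le)]
  ring

/-- The Massey output is homogeneous of degree `degSum deg 1 l + 1`. -/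
theorem IsDefiningSystem.masseyOut_mem {D : DGA F A} {l : ℕ} {deg : ℕ → ℤ} {x : ℕ → A}
    {a : ℕ → ℕ → A} (ha : D.IsDefiningSystem l deg x a) :
    D.masseyOut l deg a ∈ D.grading (degSum deg 1 l + 1) := by
  refine Submodule.sum_mem _ fun k hk => Submodule.smul_mem _ _ ?_
  obtain ⟨hk1, hkl⟩ := Finset.mem_Ico.1 hk
  rw [← degSum_add_degSum deg hk1 hkl]
  exact D.mul_mem (ha.2.1 1 k le_rfl hk1 hkl.le) (ha.2.1 (k + 1) l (by omega) hkl le_rfl)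

/-- A Massey product with an exact entry is trivial: all entries of a defining system whose
index interval contains that position may be replaced by `0`. -/
theorem IsDefiningSystem.masseyTrivial_of_isExact {D : DGA F A} {l : ℕ} {deg : ℕ → ℤ}
    {x : ℕ → A} {a : ℕ → ℕ → A} (ha : D.IsDefiningSystem l deg x a) {p : ℕ} (hp : 1 ≤ p)
    (hpl : p ≤ l) (hxp : D.IsExact (x p)) : D.MasseyTrivial l deg x := by
  set a' : ℕ → ℕ → A := fun i j => if i ≤ p ∧ p ≤ j then 0 else a i j
  have hzero : ∀ i j, i ≤ p → p ≤ j → a' i j = 0 := fun i j h₁ h₂ => if_pos ⟨h₁, h₂⟩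
  have hsame : ∀ i j, ¬(i ≤ p ∧ p ≤ j) → a' i j = a i j := fun i j h => if_neg h
  have hprod : ∀ i j k, i ≤ p → p ≤ j → a' i k * a' (k + 1) j = 0 := by
    intro i j k h₁ h₂
    rcases le_or_gt p k with h | h
    · rw [hzero i k h₁ h, zero_mul]
    · rw [hzero (k + 1) j h h₂, mul_zero]
  refine ⟨a', ⟨?_, ?_, ?_⟩, 0, ?_⟩
  · intro i hi hil
    by_cases hip : i = p
    · subst hip
      obtain ⟨b, hb⟩ := hxp
      rw [hzero i i le_rfl le_rfl]
      exact ⟨Submodule.zero_mem _, map_zero _, -b, by rw [hb, map_neg, zero_sub]⟩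
    · rw [hsame i i (by omega)]
      exact ha.1 i hi hil
  · intro i j hi hij hjl
    by_cases h : i ≤ p ∧ p ≤ j
    · rw [hzero i j h.1 h.2]
      exact Submodule.zero_mem _
    · rw [hsame i j h]
      exact ha.2.1 i j hi hij hjl
  · intro i j hi hij hjl hne
    by_cases h : i ≤ p ∧ p ≤ j
    · rw [hzero i j h.1 h.2, map_zero]
      exact (Finset.sum_eq_zero fun k _ => by rw [hprod i j k h.1 h.2, smul_zero]).symm
    · rw [hsame i j h, ha.2.2 i j hi hij hjl hne]
      refine Finset.sum_congr rfl fun k hk => ?_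
      obtain ⟨hk1, hk2⟩ := Finset.mem_Ico.1 hk
      rw [hsame i k (by omega), hsame (k + 1) j (by omega)]
  · rw [map_zero]
    exact Finset.sum_eq_zero fun k _ => by rw [hprod 1 l k hp hpl, smul_zero]

theorem IsExact.smul {D : DGA F A} {a : A} (h : D.IsExact a) (c : F) : D.IsExact (c • a) := by
  obtain ⟨b, rfl⟩ := h
  exact ⟨c • b, (map_smul _ _ _).symm⟩

theorem Cohomologous.isExact {D : DGA F A} {a b : A} (h : D.Cohomologous a b)
    (ha : D.IsExact a) : D.IsExact b := by
  obtain ⟨c, hc⟩ := h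
  obtain ⟨e, rfl⟩ := ha
  exact ⟨e - c, by rw [map_sub, ← hc, sub_sub_cancel]⟩

theorem isExact_of_isExact_smul {D : DGA F A} {a : A} {c : F} (hc : c ≠ 0)
    (h : D.IsExact (c • a)) : D.IsExact a := by
  simpa [smul_smul, inv_mul_cancel₀ hc] using h.smul c⁻¹

/-- Consecutive entries of a defining system have exact product. -/
theorem IsDefiningSystem.isExact_mul_succ {D : DGA F A} {l : ℕ} (hl : 3 ≤ l) {deg : ℕ → ℤ}
    {x : ℕ → A} {a : ℕ → ℕ → A} (ha : D.IsDefiningSystem l deg x a) {i : ℕ} (hi : 1 ≤ i)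
    (hil : i < l) : D.IsExact (a i i * a (i + 1) (i + 1)) := by
  have h := ha.2.2 i (i + 1) hi (by omega) hil (by omega)
  rw [Nat.Ico_succ_singleton, Finset.sum_singleton] at h
  exact isExact_of_isExact_smul (zpow_ne_zero _ (neg_ne_zero.2 one_ne_zero)) ⟨_, h.symm⟩

theorem IsDefiningSystem.masseyTrivial_of_deg_eq_zero {D : DGA F A} (hD : D.Connected) {l : ℕ}
    (hl : 3 ≤ l) {deg : ℕ → ℤ} {x : ℕ → A} {a : ℕ → ℕ → A} (ha : D.IsDefiningSystem l deg x a)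
    {p : ℕ} (hp : 1 ≤ p) (hpl : p ≤ l) (hdeg : deg p = 0) : D.MasseyTrivial l deg x := by
  obtain ⟨hmem, hd, hcoh⟩ := ha.1 p hp hpl
  obtain ⟨c, hc⟩ := hD _ (hdeg ▸ hmem) hd
  rcases eq_or_ne c 0 with rfl | hc0
  · exact ha.masseyTrivial_of_isExact hp hpl
      (hcoh.isExact ⟨0, by rw [hc, zero_smul, map_zero]⟩)
  · rcases hpl.lt_or_eq with hlt | rfl
    · have h := ha.isExact_mul_succ hl hp hlt
      rw [hc, smul_mul_assoc, one_mul] at h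
      exact ha.masseyTrivial_of_isExact (p := p + 1) (by omega) hlt
        ((ha.1 (p + 1) (by omega) hlt).2.2.isExact (isExact_of_isExact_smul hc0 h))
    · obtain ⟨m, rfl⟩ : ∃ m, p = m + 1 := ⟨p - 1, by omega⟩
      have h := ha.isExact_mul_succ hl (i := m) (by omega) (by omega)
      rw [hc, mul_smul_comm, mul_one] at h
      exact ha.masseyTrivial_of_isExact (p := m) (by omega) (by omega)
        ((ha.1 m (by omega) (by omega)).2.2.isExact (isExact_of_isExact_smul hc0 h))

/-- Adding a cocycle `z` to the entry `a 1 m` of a defining system for an `(m + 1)`-tuple gives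
a defining system whose output changes by `± z * a (m + 1) (m + 1)`. -/
theorem IsDefiningSystem.exists_masseyOut_add {D : DGA F A} {m : ℕ} (hm : 2 ≤ m) {deg : ℕ → ℤ}
    {x : ℕ → A} {a : ℕ → ℕ → A} (ha : D.IsDefiningSystem (m + 1) deg x a) {z : A}
    (hz : z ∈ D.Zc (degSum deg 1 m)) :
    ∃ a', D.IsDefiningSystem (m + 1) deg x a' ∧
      D.masseyOut (m + 1) deg a' = D.masseyOut (m + 1) deg a +
        ((-1 : F) ^ degSum deg 1 m) • (z * a (m + 1) (m + 1)) := by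
  obtain ⟨hzdeg, hzd⟩ := hz
  set a' : ℕ → ℕ → A := fun i j => if i = 1 ∧ j = m then a 1 m + z else a i j
  have hnew : a' 1 m = a 1 m + z := if_pos ⟨rfl, rfl⟩
  have hsame : ∀ i j, ¬(i = 1 ∧ j = m) → a' i j = a i j := fun i j h => if_neg h
  refine ⟨a', ⟨?_, ?_, ?_⟩, ?_⟩
  · intro i hi hil
    rw [hsame i i (by omega)]
    exact ha.1 i hi hil
  · intro i j hi hij hjl
    by_cases h : i = 1 ∧ j = m
    · obtain ⟨rfl, rfl⟩ := h
      rw [hnew]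
      exact Submodule.add_mem _ (ha.2.1 _ _ hi hij hjl) hzdeg
    · rw [hsame i j h]
      exact ha.2.1 i j hi hij hjl
  · intro i j hi hij hjl hne
    have hd : D.d (a' i j) = D.d (a i j) := by
      by_cases h : i = 1 ∧ j = m
      · obtain ⟨rfl, rfl⟩ := h
        rw [hnew, map_add, LinearMap.mem_ker.1 hzd, add_zero]
      · rw [hsame i j h]
    rw [hd, ha.2.2 i j hi hij hjl hne]
    refine Finset.sum_congr rfl fun k hk => ?_
    obtain ⟨hk1, hk2⟩ := Finset.mem_Ico.1 hk
    rw [hsame i k (by omega), hsame (k + 1) j (by omega)]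
  · unfold masseyOut
    rw [Finset.sum_Ico_succ_top (by omega), Finset.sum_Ico_succ_top (by omega), hnew,
      hsame (m + 1) (m + 1) (by omega), add_mul, smul_add, add_assoc]
    congr 1
    refine Finset.sum_congr rfl fun k hk => ?_
    obtain ⟨hk1, hk2⟩ := Finset.mem_Ico.1 hk
    rw [hsame 1 k (by omega), hsame (k + 1) (m + 1) (by omega)]

end DGA

namespace PoincareDGCA

variable {F : Type u} {A : Type v} [Field F] [Ring A] [Algebra F A] {n : ℤ}

/-- In a connected Poincaré DGCA, a top degree element with zero integral is exact. -/
theorem isExact_of_intg_eq_zero (P : PoincareDGCA F A n) (hP : P.toDGA.Connected) {a : A}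
    (ha : a ∈ P.grading n) (hint : P.intg a = 0) : P.toDGA.IsExact a := by
  have hda : P.d a = 0 := by
    have h := P.d_mem ha
    rwa [P.top (n + 1) (by omega), Submodule.mem_bot] at h
  refine P.nondeg n a ha hda fun b hb hdb => ?_
  rw [sub_self] at hb
  obtain ⟨c, rfl⟩ := hP b hb hdb
  rw [mul_smul_comm, mul_one, map_smul, hint, smul_zero]

/-- A cocycle that is not exact pairs nontrivially, from the right, with some cocycle. -/
theorem exists_intg_mul_ne_zero (P : PoincareDGCA F A n) {i : ℤ} {a : A} (ha : a ∈ P.grading i)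
    (hda : P.d a = 0) (hne : ¬P.toDGA.IsExact a) :
    ∃ b ∈ P.toDGA.Zc (n - i), P.intg (b * a) ≠ 0 := by
  by_contra! h
  refine hne (P.nondeg i a ha hda fun b hb hdb => ?_)
  rw [P.gcomm a b ha hb, map_smul, h b ⟨hb, hdb⟩, smul_zero]

theorem masseyTrivial_of_top_degree (P : PoincareDGCA F A n) (hP : P.toDGA.Connected) {m : ℕ}
    (hm : 2 ≤ m) {deg : ℕ → ℤ} {x : ℕ → A} {a : ℕ → ℕ → A}
    (ha : P.toDGA.IsDefiningSystem (m + 1) deg x a) (hn : DGA.degSum deg 1 (m + 1) + 1 = n) :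
    P.toDGA.MasseyTrivial (m + 1) deg x := by
  obtain ⟨hmem, hd, hcoh⟩ := ha.1 (m + 1) (by omega) le_rfl
  by_cases hex : P.toDGA.IsExact (a (m + 1) (m + 1))
  · exact ha.masseyTrivial_of_isExact (by omega) le_rfl (hcoh.isExact hex)
  obtain ⟨b, hb, hne⟩ := P.exists_intg_mul_ne_zero hmem hd hex
  have hdeg : n - deg (m + 1) = DGA.degSum deg 1 m := by
    have h := DGA.degSum_add_degSum deg (i := 1) (k := m) (j := m + 1) (by omega) (by omega)
    have h' : DGA.degSum deg (m + 1) (m + 1) = deg (m + 1) := by simp [DGA.degSum]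
    omega
  rw [hdeg] at hb
  set s : F := (-1) ^ DGA.degSum deg 1 m
  have hs : s ≠ 0 := zpow_ne_zero _ (neg_ne_zero.2 one_ne_zero)
  obtain ⟨a', ha', hout⟩ := ha.exists_masseyOut_add hm (Submodule.smul_mem _
    (-(P.intg (P.toDGA.masseyOut (m + 1) deg a) / (s * P.intg (b * a (m + 1) (m + 1))))) hb)
  refine ⟨a', ha', P.isExact_of_intg_eq_zero hP (hn ▸ ha'.masseyOut_mem) ?_⟩
  rw [hout, map_add, map_smul, smul_mul_assoc, map_smul, smul_eq_mul, smul_eq_mul]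
  change _ + s * _ = 0
  field_simp
  ring

end PoincareDGCA

/-- Let `A*` be a DGCA and `(x 1, …, x l)`, `l ≥ 3`, a Massey
`l`-tuple of homogeneous cohomology classes.  The `l`-th order Massey product is trivial
if (1) some `x p = 0`; (2) `A*` is connected and some `|x p| = 0`; (3) `A*` is a
connected Poincaré DGCA of degree `n` and `∑ |x i| + 2 - l = n`. -/
theorem statement_17 {F : Type u} {A : Type v} [Field F] [Ring A] [Algebra F A]
    (D : DGCA F A) (l : ℕ) (hl : 3 ≤ l) (deg : ℕ → ℤ) (x : ℕ → A)
    (hx : D.toDGA.IsMasseyTuple l deg x) :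
    -- (1)
    ((∃ p : ℕ, 1 ≤ p ∧ p ≤ l ∧ D.toDGA.IsExact (x p)) →
      D.toDGA.MasseyTrivial l deg x) ∧
    -- (2)
    (D.toDGA.Connected → (∃ p : ℕ, 1 ≤ p ∧ p ≤ l ∧ deg p = 0) →
      D.toDGA.MasseyTrivial l deg x) ∧
    -- (3)
    (∀ (n : ℤ) (P : PoincareDGCA F A n), P.toDGCA = D → D.toDGA.Connected →
      (∑ i ∈ Finset.Icc 1 l, deg i) + 2 - (l : ℤ) = n →
      D.toDGA.MasseyTrivial l deg x) := by
  obtain ⟨-, a, ha⟩ := hx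
  refine ⟨?_, ?_, ?_⟩
  · rintro ⟨p, hp, hpl, hxp⟩
    exact ha.masseyTrivial_of_isExact hp hpl hxp
  · rintro hD ⟨p, hp, hpl, hdeg⟩
    exact ha.masseyTrivial_of_deg_eq_zero hD hl hp hpl hdeg
  · rintro n P rfl hD hn
    obtain ⟨m, rfl⟩ : ∃ m, l = m + 1 := ⟨l - 1, by omega⟩
    refine P.masseyTrivial_of_top_degree hD (by omega) ha ?_
    rw [← hn, DGA.degSum, Nat.add_sub_cancel]
    push_cast
    ring
end
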